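/- Let Γ be a countable group, βΓ the Stone–Čech compactification of Γ with the discrete topology, with Γ acting on βΓ by the continuous extension of left translation, and let M ⊆ βΓ be a nonempty closed Γ-invariant subset that is minimal among such subsets (a minimal subflow). Then the clopen type semigroup T(Γ ↷ M) is unperforated, the algebraic preorder ≤ on T(Γ ↷ M) is a partial order (antisymmetric), and the action Γ ↷ M has dynamical comparison. -/

import Mathlib

open MeasureTheory Set
open scoped ENNReal

/-! Preliminary definitions: the clopen type semigroup of an action of a group `Γ`
by homeomorphisms on a topological space `X`, invariant measures, dynamical comparison,
topological full groups, and the topology on spaces of actions. -/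

/-- The group of self-homeomorphisms of `X`, with `(g * h) x = g (h x)`. -/
instance homeoGroup (X : Type*) [TopologicalSpace X] : Group (X ≃ₜ X) where
  mul g h := h.trans g
  one := Homeomorph.refl X
  inv := Homeomorph.symm
  mul_assoc a b c := Homeomorph.ext fun _ => rfl
  one_mul a := Homeomorph.ext fun _ => rfl
  mul_one a := Homeomorph.ext fun _ => rfl
  inv_mul_cancel a := Homeomorph.ext fun x => a.symm_apply_apply x

/-- The Cantor space `{0,1}^ℕ`. -/
abbrev Cantor : Type := ℕ → Bool

section Defs

variable {Γ : Type*} [Group Γ] {X : Type*} [TopologicalSpace X]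

/-- A left-invariant finitely additive probability measure on (the power set of) `Γ`,
with values in `[0,1]`. `Γ` is amenable iff such a measure exists. -/
def IsInvFapm {Γ : Type*} [Group Γ] (m : Set Γ → ℝ) : Prop :=
  (∀ E : Set Γ, 0 ≤ m E) ∧ (∀ E : Set Γ, m E ≤ 1) ∧ m Set.univ = 1 ∧
  (∀ E F : Set Γ, Disjoint E F → m (E ∪ F) = m E + m F) ∧
  (∀ (γ : Γ) (E : Set Γ), m ((γ * ·) '' E) = m E)

/-- The action of `γ ∈ Γ` on continuous `ℕ`-valued functions: `(γ · f)(x) = f(γ⁻¹ · x)`. -/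
def actC (α : Γ →* X ≃ₜ X) (γ : Γ) (f : C(X, ℕ)) : C(X, ℕ) :=
  f.comp (α γ⁻¹)

/-- The equidecomposability relation `∼` on `C(X, ℕ)`: `f ∼ g` iff `f = h₁ + ⋯ + hₙ`
and `g = γ₁·h₁ + ⋯ + γₙ·hₙ` for some `hᵢ ∈ C(X,ℕ)`, `γᵢ ∈ Γ`. -/
def TypeRel (α : Γ →* X ≃ₜ X) (f g : C(X, ℕ)) : Prop :=
  ∃ (n : ℕ) (h : Fin n → C(X, ℕ)) (γ : Fin n → Γ),
    f = ∑ i, h i ∧ g = ∑ i, actC α (γ i) (h i)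

/-- The additive congruence on `C(X, ℕ)` generated by `∼` (since `∼` is itself an
additive congruence, this is just `∼`). -/
def typeCon (α : Γ →* X ≃ₜ X) : AddCon C(X, ℕ) := addConGen (TypeRel α)

/-- The clopen type semigroup `T(α) = C(X,ℕ)/∼`. -/
abbrev TypeSemigroup (α : Γ →* X ≃ₜ X) := (typeCon α).Quotient

/-- The class `[f] ∈ T(α)` of `f ∈ C(X, ℕ)`. -/
def cls (α : Γ →* X ≃ₜ X) (f : C(X, ℕ)) : TypeSemigroup α := (typeCon α).toQuotient f

/-- The algebraic preorder on `T(α)`: `a ≤ b` iff `a + c = b` for some `c`. -/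
def tle (α : Γ →* X ≃ₜ X) (a b : TypeSemigroup α) : Prop := ∃ c, a + c = b

/-- `T(α)` is unperforated: `n • a ≤ n • b` implies `a ≤ b` for all `n ≥ 1`. -/
def IsUnperforated (α : Γ →* X ≃ₜ X) : Prop :=
  ∀ (a b : TypeSemigroup α) (n : ℕ), 1 ≤ n → tle α (n • a) (n • b) → tle α a b

/-- `T(α)` is almost unperforated: `(n+1) • a ≤ n • b` implies `a ≤ b`. -/
def IsAlmostUnperforated (α : Γ →* X ≃ₜ X) : Prop :=
  ∀ (a b : TypeSemigroup α) (n : ℕ), tle α ((n + 1) • a) (n • b) → tle α a b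

/-- `T(α)` is cancellative: `a + b = a + c` implies `b = c`. -/
def IsCancellative (α : Γ →* X ≃ₜ X) : Prop :=
  ∀ a b c : TypeSemigroup α, a + b = a + c → b = c

/-- The algebraic preorder on `T(α)` is a partial order, i.e. it is antisymmetric. -/
def TleAntisymm (α : Γ →* X ≃ₜ X) : Prop :=
  ∀ a b : TypeSemigroup α, tle α a b → tle α b a → a = b

/-- `b` is an order unit of `T(α)`: every `a` satisfies `a ≤ k • b` for some `k ∈ ℕ`. -/
def IsOrderUnit (α : Γ →* X ≃ₜ X) (b : TypeSemigroup α) : Prop :=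
  ∀ a : TypeSemigroup α, ∃ k : ℕ, tle α a (k • b)

/-- A state on `T(α)`: an additive map to `[0,∞]` sending `0` to `0`. -/
def IsState (α : Γ →* X ≃ₜ X) (ν : TypeSemigroup α → ℝ≥0∞) : Prop :=
  ν 0 = 0 ∧ ∀ a b : TypeSemigroup α, ν (a + b) = ν a + ν b

/-- `M(α)`: the set of `Γ`-invariant Radon (regular Borel) probability measures on `X`. -/
def invRadon (α : Γ →* X ≃ₜ X) : Set (@Measure X (borel X)) :=
  letI : MeasurableSpace X := borel X
  {μ : Measure X | IsProbabilityMeasure μ ∧ μ.Regular ∧ ∀ γ : Γ, Measure.map ⇑(α γ) μ = μ}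

/-- The set of `Γ`-invariant Borel probability measures on `X`. -/
def invBorel (α : Γ →* X ≃ₜ X) : Set (@Measure X (borel X)) :=
  letI : MeasurableSpace X := borel X
  {μ : Measure X | IsProbabilityMeasure μ ∧ ∀ γ : Γ, Measure.map ⇑(α γ) μ = μ}

/-- `μ([f]) = ∫ f dμ`, the value of (the state associated with) a measure on the class of
`f ∈ C(X, ℕ)`. -/
noncomputable def intOf {X : Type*} [TopologicalSpace X] (μ : @Measure X (borel X))
    (f : C(X, ℕ)) : ℝ :=
  letI : MeasurableSpace X := borel X
  ∫ x, (f x : ℝ) ∂μ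

/-- `A` is subequidecomposable to `B`: there are a partition `A = A₁ ⊔ ⋯ ⊔ Aₙ` into clopen
sets and `γ₁, …, γₙ ∈ Γ` with `γ₁A₁, …, γₙAₙ` pairwise disjoint and contained in `B`. -/
def Subequidecomposable (α : Γ →* X ≃ₜ X) (A B : Set X) : Prop :=
  ∃ (n : ℕ) (P : Fin n → Set X) (γ : Fin n → Γ),
    (∀ i, IsClopen (P i)) ∧ (Pairwise fun i j => Disjoint (P i) (P j)) ∧
    (⋃ i, P i) = A ∧
    (Pairwise fun i j => Disjoint (⇑(α (γ i)) '' P i) (⇑(α (γ j)) '' P j)) ∧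
    ∀ i, ⇑(α (γ i)) '' P i ⊆ B

/-- Dynamical comparison (with respect to invariant Radon probability measures): for all
clopen `A`, `B` with `B` nonempty and `μ(A) < μ(B)` for every `μ ∈ M(α)`, `A` is
subequidecomposable to `B`. -/
def DynComparison (α : Γ →* X ≃ₜ X) : Prop :=
  ∀ A B : Set X, IsClopen A → IsClopen B → B.Nonempty →
    (∀ μ ∈ invRadon α, μ A < μ B) → Subequidecomposable α A B

/-- Dynamical comparison (with respect to invariant Borel probability measures). -/
def DynComparisonBorel (α : Γ →* X ≃ₜ X) : Prop :=
  ∀ A B : Set X, IsClopen A → IsClopen B → B.Nonempty →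
    (∀ μ ∈ invBorel α, μ A < μ B) → Subequidecomposable α A B

/-- The action `α` is minimal: the only closed invariant subsets are `∅` and `X`. -/
def IsMinimalAction (α : Γ →* X ≃ₜ X) : Prop :=
  ∀ F : Set X, IsClosed F → (∀ γ : Γ, ⇑(α γ) '' F ⊆ F) → F = ∅ ∨ F = Set.univ

/-- Membership in the topological full group `⟦α⟧`: `g` coincides with elements of the
action on the pieces of a finite clopen partition of `X`. -/
def InTopFullGroup (α : Γ →* X ≃ₜ X) (g : X ≃ₜ X) : Prop :=
  ∃ (n : ℕ) (P : Fin n → Set X) (γ : Fin n → Γ),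
    (∀ i, IsClopen (P i)) ∧ (Pairwise fun i j => Disjoint (P i) (P j)) ∧
    (⋃ i, P i) = Set.univ ∧ ∀ i, ∀ x ∈ P i, g x = α (γ i) x

/-- `⟦α⟧` admits a dense locally finite subgroup: there is a subgroup `Λ` of `Homeo(X)`
contained in `⟦α⟧`, locally finite (all its finitely generated subgroups are finite), and
dense in `⟦α⟧` for the topology whose basic neighborhoods of `h` are
`{g : g A = h A for all A ∈ 𝒜}`, `𝒜` ranging over finite clopen partitions of `X`. -/
def HasDenseLocallyFiniteSubgroup (α : Γ →* X ≃ₜ X) : Prop :=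
  ∃ Λ : Subgroup (X ≃ₜ X),
    ((Λ : Set (X ≃ₜ X)) ⊆ {g | InTopFullGroup α g}) ∧
    (∀ s : Finset (X ≃ₜ X), (s : Set (X ≃ₜ X)) ⊆ (Λ : Set (X ≃ₜ X)) →
      ((Subgroup.closure (s : Set (X ≃ₜ X)) : Subgroup (X ≃ₜ X)) : Set (X ≃ₜ X)).Finite) ∧
    ∀ g : X ≃ₜ X, InTopFullGroup α g →
      ∀ (n : ℕ) (P : Fin n → Set X), (∀ i, IsClopen (P i)) →
        (Pairwise fun i j => Disjoint (P i) (P j)) → (⋃ i, P i) = Set.univ →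
        ∃ l ∈ Λ, ∀ i, ⇑l '' P i = ⇑g '' P i

end Defs

/-- The topology on `Homeo(X)` whose basic neighborhoods of `h` are the sets
`{g : g A = h A for all A ∈ 𝒜}`, for `𝒜` a finite clopen partition of `X`; equivalently,
the topology generated by the sets `{g : g '' A = B}` for `A`, `B` clopen. -/
def homeoTop (X : Type*) [TopologicalSpace X] : TopologicalSpace (X ≃ₜ X) :=
  TopologicalSpace.generateFrom
    {U | ∃ A B : Set X, IsClopen A ∧ IsClopen B ∧ U = {g : X ≃ₜ X | ⇑g '' A = B}}

/-- The topology on the space `A(Γ)` of actions of `Γ` on `X`, induced from the product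
topology on `Homeo(X)^Γ`. -/
def actionTop (Γ : Type*) [Group Γ] (X : Type*) [TopologicalSpace X] :
    TopologicalSpace (Γ →* (X ≃ₜ X)) :=
  letI := homeoTop X
  TopologicalSpace.induced (fun φ : Γ →* (X ≃ₜ X) => ⇑φ) Pi.topologicalSpace

section Comb

variable {Γ : Type*} [Group Γ]

def wE (F G : Γ → ℕ) : Prop :=
  ∃ S : Finset Γ, ∃ θ : (Σ x, Fin (F x)) ≃ (Σ x, Fin (G x)), ∀ p, ∃ s ∈ S, (θ p).1 = s * p.1

def wLe (F G : Γ → ℕ) : Prop :=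
  ∃ S : Finset Γ, ∃ θ : (Σ x, Fin (F x)) → (Σ x, Fin (G x)), Function.Injective θ ∧
    ∀ p, ∃ s ∈ S, (θ p).1 = s * p.1

theorem wE.le {F G : Γ → ℕ} (h : wE F G) : wLe F G := by
  obtain ⟨S, θ, hθ⟩ := h
  exact ⟨S, θ, θ.injective, hθ⟩

theorem wE_refl (F : Γ → ℕ) : wE F F :=
  ⟨{1}, Equiv.refl _, fun p => ⟨1, by simp, by simp⟩⟩

theorem wE.symm {F G : Γ → ℕ} (h : wE F G) : wE G F := by
  classical
  obtain ⟨S, θ, hθ⟩ := h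
  refine ⟨S.image (·⁻¹), θ.symm, fun p => ?_⟩
  obtain ⟨s, hs, h⟩ := hθ (θ.symm p)
  refine ⟨s⁻¹, Finset.mem_image_of_mem _ hs, ?_⟩
  rw [Equiv.apply_symm_apply] at h
  rw [h]; simp

theorem wLe.trans {F G H : Γ → ℕ} (h : wLe F G) (h' : wLe G H) : wLe F H := by
  classical
  obtain ⟨S, θ, hi, hθ⟩ := h
  obtain ⟨S', θ', hi', hθ'⟩ := h'
  refine ⟨(S' ×ˢ S).image (fun q => q.1 * q.2), θ' ∘ θ, hi'.comp hi, fun p => ?_⟩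
  obtain ⟨s, hs, h⟩ := hθ p
  obtain ⟨s', hs', h'⟩ := hθ' (θ p)
  refine ⟨s' * s, Finset.mem_image.2 ⟨(s', s), by simp [hs, hs'], rfl⟩, ?_⟩
  simp [h', h, mul_assoc]

theorem wE.trans {F G H : Γ → ℕ} (h : wE F G) (h' : wE G H) : wE F H := by
  classical
  obtain ⟨S, θ, hθ⟩ := h
  obtain ⟨S', θ', hθ'⟩ := h'
  refine ⟨(S' ×ˢ S).image (fun q => q.1 * q.2), θ.trans θ', fun p => ?_⟩
  obtain ⟨s, hs, h⟩ := hθ p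
  obtain ⟨s', hs', h'⟩ := hθ' (θ p)
  refine ⟨s' * s, Finset.mem_image.2 ⟨(s', s), by simp [hs, hs'], rfl⟩, ?_⟩
  simp [h', h, mul_assoc]

def splitEquiv (F G : Γ → ℕ) : (Σ x, Fin ((F + G) x)) ≃ (Σ x, Fin (F x)) ⊕ (Σ x, Fin (G x)) :=
  (Equiv.sigmaCongrRight (fun _ => finSumFinEquiv.symm)).trans (Equiv.sigmaSumDistrib _ _)

def sumBase {F G : Γ → ℕ} : (Σ x, Fin (F x)) ⊕ (Σ x, Fin (G x)) → Γ :=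
  Sum.elim Sigma.fst Sigma.fst

theorem splitEquiv_base (F G : Γ → ℕ) (p) : sumBase (splitEquiv F G p) = p.1 := by
  obtain ⟨x, i⟩ := p
  simp only [splitEquiv, Equiv.trans_apply, Equiv.sigmaCongrRight_apply]
  rcases h : finSumFinEquiv.symm i with a | a <;> simp [Equiv.sigmaSumDistrib, sumBase]

theorem splitEquiv_symm_base (F G : Γ → ℕ) (q) : ((splitEquiv F G).symm q).1 = sumBase q := by
  rw [← splitEquiv_base, Equiv.apply_symm_apply]

theorem wE.add {F G F' G' : Γ → ℕ} (h : wE F G) (h' : wE F' G') : wE (F + F') (G + G') := by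
  classical
  obtain ⟨S, θ, hθ⟩ := h
  obtain ⟨S', θ', hθ'⟩ := h'
  refine ⟨S ∪ S', ((splitEquiv F F').trans (Equiv.sumCongr θ θ')).trans (splitEquiv G G').symm, 
    fun p => ?_⟩
  rw [Equiv.trans_apply, Equiv.trans_apply, splitEquiv_symm_base, ← splitEquiv_base F F' p]
  rcases splitEquiv F F' p with q | q
  · obtain ⟨s, hs, h⟩ := hθ q
    exact ⟨s, by simp [hs], by simpa [sumBase] using h⟩
  · obtain ⟨s, hs, h⟩ := hθ' q
    exact ⟨s, by simp [hs], by simpa [sumBase] using h⟩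

theorem sigmaFin_ext {F : Γ → ℕ} {p q : Σ x, Fin (F x)} (h : p.1 = q.1) (h' : p.2.1 = q.2.1) :
    p = q := by
  obtain ⟨x, i⟩ := p
  obtain ⟨y, j⟩ := q
  obtain rfl : x = y := h
  obtain rfl : i = j := Fin.ext h'
  rfl

theorem wE_translate (F : Γ → ℕ) (γ : Γ) : wE F (fun x => F (γ⁻¹ * x)) := by
  refine wE.symm ⟨{γ⁻¹}, ⟨fun p => ⟨γ⁻¹ * p.1, p.2⟩, fun p => ⟨γ * p.1, ⟨p.2.1, by simp⟩⟩, ?_, ?_⟩,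
    fun p => ⟨γ⁻¹, by simp, rfl⟩⟩
  · intro p
    exact sigmaFin_ext (F := fun x => F (γ⁻¹ * x)) (by simp) rfl
  · intro p
    exact sigmaFin_ext (by simp) rfl

theorem wLe_of_le {F G : Γ → ℕ} (h : ∀ x, F x ≤ G x) : wLe F G := by
  refine ⟨{1}, fun p => ⟨p.1, Fin.castLE (h p.1) p.2⟩, ?_, fun p => ⟨1, by simp, by simp⟩⟩
  rintro ⟨x, i⟩ ⟨y, j⟩ hh
  simp only [Sigma.mk.injEq] at hh
  obtain ⟨rfl, hh⟩ := hh
  simp at hh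
  simp [hh]

theorem wLe_antisymm {F G : Γ → ℕ} (h : wLe F G) (h' : wLe G F) : wE F G := by
  classical
  obtain ⟨S, θ, hi, hθ⟩ := h
  obtain ⟨S', θ', hi', hθ'⟩ := h'
  obtain ⟨k, hk, hR⟩ := Function.Embedding.schroeder_bernstein_of_rel hi hi'
    (fun p q => ∃ s ∈ S ∪ S'.image (·⁻¹), q.1 = s * p.1)
    (fun a => by
      obtain ⟨s, hs, h⟩ := hθ a
      exact ⟨s, by simp [hs], h⟩)
    (fun b => by
      obtain ⟨s, hs, h⟩ := hθ' b
      exact ⟨s⁻¹, Finset.mem_union_right _ (Finset.mem_image_of_mem _ hs), by simp [h]⟩)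
  exact ⟨_, Equiv.ofBijective k hk, hR⟩

theorem decomp_aux {F G : Γ → ℕ} (S : Finset Γ) (θ : (Σ x, Fin (F x)) → (Σ x, Fin (G x)))
    (hi : Function.Injective θ) (hS : ∀ p, ∃ s ∈ S, (θ p).1 = s * p.1) :
    ∃ h : Γ → Γ → ℕ, (∀ x, F x = ∑ s ∈ S, h s x) ∧ (∀ y, ∑ s ∈ S, h s (s⁻¹ * y) ≤ G y) ∧
      (Function.Surjective θ → ∀ y, ∑ s ∈ S, h s (s⁻¹ * y) = G y) := by
  classical
  refine ⟨fun s x => (Finset.univ.filter (fun i : Fin (F x) => (θ ⟨x, i⟩).1 = s * x)).card, 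
    ?_, ?_⟩
  · intro x
    have := Finset.card_eq_sum_card_fiberwise (s := (Finset.univ : Finset (Fin (F x)))) (t := S)
      (f := fun i => (θ ⟨x, i⟩).1 * x⁻¹) (fun i _ => by
        obtain ⟨s, hs, h⟩ := hS ⟨x, i⟩
        simp [h, hs])
    simpa [mul_inv_eq_iff_eq_mul] using this
  · have hT : ∀ y : Γ, (Finset.univ.image (fun j : Fin (G y) => (⟨y, j⟩ : Σ x, Fin (G x)))).card = G y := by
      intro y
      rw [Finset.card_image_of_injective _ sigma_mk_injective]; simp
    have hmem : ∀ (y : Γ) (p : Σ x, Fin (G x)), 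
        p ∈ Finset.univ.image (fun j : Fin (G y) => (⟨y, j⟩ : Σ x, Fin (G x))) ↔ p.1 = y := by
      rintro y ⟨z, j⟩
      simp only [Finset.mem_image, Finset.mem_univ, true_and]
      constructor
      · rintro ⟨a, ha⟩; exact (congrArg Sigma.fst ha).symm
      · rintro rfl; exact ⟨j, rfl⟩
    let D : (y : Γ) → Finset (Σ s : Γ, Fin (F (s⁻¹ * y))) := fun y => S.sigma (fun s => 
      Finset.univ.filter (fun i : Fin (F (s⁻¹ * y)) => (θ ⟨s⁻¹ * y, i⟩).1 = s * (s⁻¹ * y)))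
    have hD : ∀ y, (D y).card = ∑ s ∈ S, (Finset.univ.filter (fun i : Fin (F (s⁻¹ * y)) =>
        (θ ⟨s⁻¹ * y, i⟩).1 = s * (s⁻¹ * y))).card := fun y => Finset.card_sigma _ _
    let φ : (y : Γ) → (Σ s : Γ, Fin (F (s⁻¹ * y))) → (Σ x, Fin (G x)) := fun y q => 
      θ ⟨q.1⁻¹ * y, q.2⟩
    have hφm : ∀ y, ∀ q ∈ D y, φ y q ∈ Finset.univ.image (fun j : Fin (G y) => (⟨y, j⟩ : Σ x, Fin (G x))) := by
      intro y q hq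
      rw [hmem]
      simp only [D, Finset.mem_sigma, Finset.mem_filter] at hq
      simpa using hq.2.2
    have hφi : ∀ y, Function.Injective (φ y) := by
      rintro y ⟨s, i⟩ ⟨t, j⟩ hh
      have := hi hh
      simp only [Sigma.mk.injEq] at this
      obtain ⟨h1, h2⟩ := this
      have : s = t := by simpa using h1
      subst this
      simpa using h2
    refine ⟨fun y => ?_, fun hsurj y => ?_⟩
    · rw [← hD, ← hT y]
      exact Finset.card_le_card_of_injOn (φ y) (hφm y) (hφi y).injOn
    · rw [← hD, ← hT y]
      refine Finset.card_bij (fun q _ => φ y q) (hφm y) (fun _ _ _ _ h => hφi y h) ?_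
      intro b hb
      obtain ⟨⟨x, i⟩, rfl⟩ := hsurj b
      rw [hmem] at hb
      obtain ⟨s, hs, h⟩ := hS ⟨x, i⟩
      rw [h] at hb
      simp only at hb
      obtain rfl : x = s⁻¹ * y := by rw [← hb]; simp
      refine ⟨⟨s, i⟩, ?_, rfl⟩
      simp [D, hs, h]

theorem wE_decomp {F G : Γ → ℕ} (h : wE F G) : ∃ (S : Finset Γ) (h : Γ → Γ → ℕ),
    (∀ x, F x = ∑ s ∈ S, h s x) ∧ (∀ y, G y = ∑ s ∈ S, h s (s⁻¹ * y)) := by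
  obtain ⟨S, θ, hθ⟩ := h
  obtain ⟨h, h1, -, h2⟩ := decomp_aux S θ θ.injective hθ
  exact ⟨S, h, h1, fun y => (h2 θ.surjective y).symm⟩

theorem wE_sum {ι : Type*} (S : Finset ι) (F G : ι → Γ → ℕ) (h : ∀ i, wE (F i) (G i)) :
    wE (∑ i ∈ S, F i) (∑ i ∈ S, G i) := by
  classical
  induction S using Finset.induction_on with
  | empty => simpa using wE_refl _
  | insert a s ha ih => 
    rw [Finset.sum_insert ha, Finset.sum_insert ha]
    exact (h a).add ih

/-- a sub-transport is completed to a full one -/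
theorem wLe_compl {F G : Γ → ℕ} (h : wLe F G) : ∃ K : Γ → ℕ, (∀ x, K x ≤ G x) ∧ wE (F + K) G := by
  obtain ⟨S, θ, hi, hθ⟩ := h
  obtain ⟨h, h1, h2, -⟩ := decomp_aux S θ hi hθ
  refine ⟨fun y => G y - ∑ s ∈ S, h s (s⁻¹ * y), fun x => Nat.sub_le _ _, ?_⟩
  have e : wE (∑ s ∈ S, h s) (∑ s ∈ S, fun x => h s (s⁻¹ * x)) := 
    wE_sum S _ _ (fun s => wE_translate (h s) s)
  have e2 := e.add (wE_refl (fun y => G y - ∑ s ∈ S, h s (s⁻¹ * y)))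
  convert e2 using 1
  · ext x; simp [h1]
  · ext y
    have := h2 y
    simp
    omega

theorem wLe_unperf {F G : Γ → ℕ} {n : ℕ} (hn : 1 ≤ n) (h : wLe (n • F) (n • G)) : wLe F G := by
  classical
  obtain ⟨S, θ, hi, hθ⟩ := h
  obtain ⟨h, h1, h2, -⟩ := decomp_aux S θ hi hθ
  let t : (Σ x, Fin (F x)) → Finset (Σ x, Fin (G x)) := fun p => 
    (S.image (· * p.1)).sigma (fun _ => Finset.univ)
  have hall := (Finset.all_card_le_biUnion_card_iff_exists_injective t).1 ?_
  · obtain ⟨f, hf, hft⟩ := hall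
    refine ⟨S, f, hf, fun p => ?_⟩
    have := hft p
    simp only [t, Finset.mem_sigma, Finset.mem_image, Finset.mem_univ, and_true] at this
    obtain ⟨s, hs, h⟩ := this
    exact ⟨s, hs, h.symm⟩
  · intro W
    let X : Finset Γ := W.image Sigma.fst
    let Y : Finset Γ := X.biUnion (fun x => S.image (· * x))
    have c1 : W.card ≤ ∑ x ∈ X, F x := by
      have : W ⊆ X.sigma (fun _ => Finset.univ) := by
        intro p hp
        simp only [X, Finset.mem_sigma, Finset.mem_univ, and_true]
        exact Finset.mem_image_of_mem _ hp
      calc _ ≤ _ := Finset.card_le_card this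
        _ = _ := by simp
    have c2 : ∑ y ∈ Y, G y ≤ (W.biUnion t).card := by
      have : Y.sigma (fun _ => Finset.univ) ⊆ W.biUnion t := by
        rintro ⟨y, j⟩ hp
        simp only [Y, X, Finset.mem_sigma, Finset.mem_univ, and_true, Finset.mem_biUnion, 
          Finset.mem_image] at hp
        obtain ⟨x, ⟨p, hp, rfl⟩, s, hs, rfl⟩ := hp
        simp only [t, Finset.mem_biUnion, Finset.mem_sigma, Finset.mem_image, Finset.mem_univ, and_true]
        exact ⟨p, hp, s, hs, rfl⟩
      calc _ = _ := by simp
        _ ≤ _ := Finset.card_le_card this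
    have c3 : n * ∑ x ∈ X, F x ≤ n * ∑ y ∈ Y, G y := by
      calc n * ∑ x ∈ X, F x = ∑ x ∈ X, ∑ s ∈ S, h s x := by
            rw [Finset.mul_sum]
            exact Finset.sum_congr rfl fun x _ => by rw [← h1]; simp
        _ = ∑ s ∈ S, ∑ x ∈ X, h s x := Finset.sum_comm
        _ ≤ ∑ s ∈ S, ∑ y ∈ Y, h s (s⁻¹ * y) := by
            refine Finset.sum_le_sum fun s hs => ?_
            calc ∑ x ∈ X, h s x = ∑ y ∈ X.image (s * ·), h s (s⁻¹ * y) := by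
                  rw [Finset.sum_image (s := X) (g := (s * ·)) (fun a _ b _ h => by simpa using h)]
                  simp
              _ ≤ _ := by
                  refine Finset.sum_le_sum_of_subset ?_
                  intro y hy
                  obtain ⟨x, hx, rfl⟩ := Finset.mem_image.1 hy
                  exact Finset.mem_biUnion.2 ⟨x, hx, Finset.mem_image_of_mem _ hs⟩
        _ = ∑ y ∈ Y, ∑ s ∈ S, h s (s⁻¹ * y) := Finset.sum_comm
        _ ≤ ∑ y ∈ Y, n * G y := Finset.sum_le_sum fun y _ => by simpa using h2 y
        _ = _ := (Finset.mul_sum _ _ _).symm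
    have c4 := Nat.le_of_mul_le_mul_left c3 (by omega)
    omega

theorem wLe_of_add {F K G : Γ → ℕ} (h : wE (F + K) G) : wLe F G :=
  (wLe_of_le (fun x => by simp)).trans h.le

end Comb

theorem alpha_mul {Γ : Type*} [Group Γ] {X : Type*} [TopologicalSpace X] (α : Γ →* X ≃ₜ X)
    (γ δ : Γ) (x : X) : α (γ * δ) x = α γ (α δ x) := by
  rw [map_mul]; rfl

theorem alpha_one {Γ : Type*} [Group Γ] {X : Type*} [TopologicalSpace X] (α : Γ →* X ≃ₜ X)
    (x : X) : α 1 x = x := by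
  rw [map_one]; rfl

theorem alpha_inv {Γ : Type*} [Group Γ] {X : Type*} [TopologicalSpace X] (α : Γ →* X ≃ₜ X)
    (γ : Γ) (x : X) : α γ⁻¹ (α γ x) = x := by
  rw [← alpha_mul, inv_mul_cancel, alpha_one]

theorem alpha_inv' {Γ : Type*} [Group Γ] {X : Type*} [TopologicalSpace X] (α : Γ →* X ≃ₜ X)
    (γ : Γ) (x : X) : α γ (α γ⁻¹ x) = x := by
  rw [← alpha_mul, mul_inv_cancel, alpha_one]

/-- The minimal subflow is an equivariant retract of `βΓ`. -/
theorem exists_retract {Γ : Type*} [Group Γ]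
    [TopologicalSpace Γ] [DiscreteTopology Γ]
    (σ : Γ →* (StoneCech Γ ≃ₜ StoneCech Γ))
    (hσ : ∀ (γ : Γ) (x : Γ), σ γ (stoneCechUnit x) = stoneCechUnit (γ * x))
    (M : Set (StoneCech Γ)) (hMne : M.Nonempty) (hMcl : IsClosed M)
    (hMmin : ∀ N : Set (StoneCech Γ), N ⊆ M → N.Nonempty → IsClosed N →
      (∀ γ : Γ, ⇑(σ γ) '' N ⊆ N) → N = M)
    (β : Γ →* (↥M ≃ₜ ↥M))
    (hβ : ∀ (γ : Γ) (m : ↥M), ((β γ m : ↥M) : StoneCech Γ) = σ γ (m : StoneCech Γ)) :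
    ∃ (e : M) (r : StoneCech Γ → M), Continuous r ∧ (∀ m : M, r m = m) ∧
      ∀ γ, r (stoneCechUnit γ) = β γ e := by
  haveI : CompactSpace M := isCompact_iff_compactSpace.1 hMcl.isCompact
  haveI : Nonempty M := hMne.to_subtype
  have hc : ∀ y : M, Continuous (fun γ : Γ => β γ y) := fun y => continuous_of_discreteTopology
  let R : M → StoneCech Γ → M := fun y => stoneCechExtend (hc y)
  have hRc : ∀ y, Continuous (R y) := fun y => continuous_stoneCechExtend _
  have hRu : ∀ y γ, R y (stoneCechUnit γ) = β γ y := fun y γ => stoneCechExtend_stoneCechUnit _ _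
  have hReq : ∀ y γ x, R y (σ γ x) = β γ (R y x) := by
    intro y γ
    refine congrFun (stoneCech_hom_ext ((hRc y).comp (σ γ).continuous)
      ((β γ).continuous.comp (hRc y)) ?_)
    funext x
    simp [hσ, hRu, alpha_mul]
  have hassoc : ∀ y z x, R z (R y x) = R (R z y) x := by
    intro y z
    refine congrFun (stoneCech_hom_ext ((hRc z).comp (continuous_subtype_val.comp (hRc y)))
      (hRc _) ?_)
    funext x
    simp [hRu, hβ, hReq]
  letI : Semigroup M :=
    { mul := fun x y => R y x
      mul_assoc := fun x y z => hassoc y z x }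
  obtain ⟨e, he⟩ := exists_idempotent_of_compact_t2_of_continuous_mul_left (M := M)
    (fun r => (hRc r).comp continuous_subtype_val)
  have he' : R e e = e := he
  refine ⟨e, R e, hRc e, ?_, hRu e⟩
  have hN := hMmin (Subtype.val '' {m : M | R e m = m}) (by rintro _ ⟨m, -, rfl⟩; exact m.2)
    ⟨e, e, he', rfl⟩ ?_ ?_
  · intro m
    obtain ⟨m', hm', h⟩ := hN.ge m.2
    rw [← Subtype.ext h]; exact hm'
  · refine hMcl.isClosedMap_subtype_val _ ?_
    exact isClosed_eq ((hRc e).comp continuous_subtype_val) continuous_id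
  · rintro γ _ ⟨_, ⟨m, hm, rfl⟩, rfl⟩
    refine ⟨β γ m, ?_, hβ γ m⟩
    show R e (β γ m) = β γ m
    rw [hβ, hReq, show R e m = m from hm]

theorem nat_ext {Γ : Type*} [TopologicalSpace Γ] [DiscreteTopology Γ] (F : Γ → ℕ) (N : ℕ)
    (hF : ∀ x, F x ≤ N) : ∃ F' : C(StoneCech Γ, ℕ), ∀ x, F' (stoneCechUnit x) = F x := by
  let g : Γ → Fin (N + 1) := fun x => ⟨F x, Nat.lt_succ_of_le (hF x)⟩
  have hg : Continuous g := continuous_of_discreteTopology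
  refine ⟨⟨fun x => (stoneCechExtend hg x).1, 
    (continuous_of_discreteTopology (f := Fin.val)).comp (continuous_stoneCechExtend hg)⟩, ?_⟩
  intro x
  simp [stoneCechExtend_stoneCechUnit, g]

theorem nat_bdd {X : Type*} [TopologicalSpace X] [CompactSpace X] (F : C(X, ℕ)) :
    ∃ N, ∀ x, F x ≤ N := by
  obtain ⟨N, hN⟩ := (isCompact_range F.continuous).bddAbove
  exact ⟨N, fun x => hN ⟨x, rfl⟩⟩

section Flow

variable {Γ : Type*} [Group Γ] [TopologicalSpace Γ] [DiscreteTopology Γ]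
    {σ : Γ →* (StoneCech Γ ≃ₜ StoneCech Γ)}
    {M : Set (StoneCech Γ)}
    {β : Γ →* (↥M ≃ₜ ↥M)}

/-- restriction to `M` -/
def resM (M : Set (StoneCech Γ)) (F : C(StoneCech Γ, ℕ)) : C(M, ℕ) :=
  F.comp ⟨Subtype.val, continuous_subtype_val⟩

theorem typeRel_of_wE 
    (hσ : ∀ (γ : Γ) (x : Γ), σ γ (stoneCechUnit x) = stoneCechUnit (γ * x))
    (hβ : ∀ (γ : Γ) (m : ↥M), ((β γ m : ↥M) : StoneCech Γ) = σ γ (m : StoneCech Γ))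
    (F G : C(StoneCech Γ, ℕ)) 
    (h : wE (fun x => F (stoneCechUnit x)) (fun x => G (stoneCechUnit x))) :
    TypeRel β (resM M F) (resM M G) := by
  classical
  obtain ⟨S, h, h1, h2⟩ := wE_decomp h
  obtain ⟨N, hN⟩ := nat_bdd F
  have hb : ∀ s : S, ∃ F' : C(StoneCech Γ, ℕ), ∀ x, F' (stoneCechUnit x) = h s x := by
    intro s
    refine nat_ext _ N fun x => ?_
    refine le_trans ?_ (hN (stoneCechUnit x))
    rw [h1]
    exact Finset.single_le_sum (f := fun s => h s x) (fun _ _ => Nat.zero_le _) s.2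
  choose H hH using hb
  have e1 : ∀ x, F x = ∑ s : S, H s x := by
    refine congrFun (stoneCech_hom_ext F.continuous ?_ ?_)
    · exact continuous_finsetSum _ fun s _ => (H s).continuous
    · funext x
      simp only [Function.comp_apply, h1, hH]
      exact (Finset.sum_coe_sort S (fun s => h s x)).symm
  have e2 : ∀ x, G x = ∑ s : S, H s (σ (s : Γ)⁻¹ x) := by
    refine congrFun (stoneCech_hom_ext G.continuous ?_ ?_)
    · exact continuous_finsetSum _ fun s _ => (H s).continuous.comp (σ _).continuous
    · funext x
      simp only [Function.comp_apply, h2, hσ, hH]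
      exact (Finset.sum_coe_sort S (fun s => h s (s⁻¹ * x))).symm
  let E := S.equivFin.symm
  refine ⟨S.card, fun i => resM M (H (E i)), fun i => (E i : Γ), ?_, ?_⟩
  · ext m
    simp only [resM, ContinuousMap.comp_apply, ContinuousMap.coe_mk, ContinuousMap.sum_apply, e1]
    exact (Equiv.sum_comp E (fun s => H s m)).symm
  · ext m
    simp only [resM, ContinuousMap.comp_apply, ContinuousMap.coe_mk, ContinuousMap.sum_apply, e2,
      actC]
    rw [← Equiv.sum_comp E]
    refine Finset.sum_congr rfl fun i _ => ?_
    rw [← hβ]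

/-- the orbit function on the group -/
def til (β : Γ →* (↥M ≃ₜ ↥M)) (e : M) (f : C(M, ℕ)) : Γ → ℕ := fun γ => f (β γ e)

theorem til_add (e : M) (f g : C(M, ℕ)) : til β e (f + g) = til β e f + til β e g := rfl

theorem til_nsmul (e : M) (f : C(M, ℕ)) (n : ℕ) : til β e (n • f) = n • til β e f := rfl

theorem til_sum {ι : Type*} (e : M) (S : Finset ι) (f : ι → C(M, ℕ)) :
    til β e (∑ i ∈ S, f i) = ∑ i ∈ S, til β e (f i) := by
  ext x; simp [til, ContinuousMap.sum_apply]

theorem wE_of_typeRel (e : M) {f g : C(M, ℕ)} (h : TypeRel β f g) :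
    wE (til β e f) (til β e g) := by
  obtain ⟨n, h, γ, rfl, rfl⟩ := h
  rw [til_sum, til_sum]
  refine wE_sum _ _ _ fun i => ?_
  convert wE_translate (til β e (h i)) (γ i) using 1
  ext x
  simp only [til, actC, alpha_mul]
  rfl

def wCon (β : Γ →* (↥M ≃ₜ ↥M)) (e : M) : AddCon C(M, ℕ) where
  r f g := wE (til β e f) (til β e g)
  iseqv := ⟨fun _ => wE_refl _, fun h => h.symm, fun h h' => h.trans h'⟩
  add' h h' := h.add h'

theorem wE_of_typeCon (e : M) {f g : C(M, ℕ)} (h : typeCon β f g) :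
    wE (til β e f) (til β e g) := by
  have : typeCon β ≤ wCon β e := AddCon.addConGen_le.2 fun f g h => wE_of_typeRel e h
  exact this h

theorem typeCon_of_typeRel {f g : C(M, ℕ)} (h : TypeRel β f g) : typeCon β f g :=
  AddConGen.Rel.of _ _ h

variable {e : M} {r : StoneCech Γ → M}

theorem til_eq (hr : Continuous r) (hre : ∀ γ, r (stoneCechUnit γ) = β γ e) (f : C(M, ℕ)) :
    til β e f = fun γ => (f.comp ⟨r, hr⟩) (stoneCechUnit γ) := by
  ext γ; simp [til, hre]

theorem res_eq (hr : Continuous r) (hrM : ∀ m : M, r m = m) (f : C(M, ℕ)) :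
    resM M (f.comp ⟨r, hr⟩) = f := by
  ext m; simp [resM, hrM]

theorem typeRel_iff (hσ : ∀ (γ : Γ) (x : Γ), σ γ (stoneCechUnit x) = stoneCechUnit (γ * x))
    (hβ : ∀ (γ : Γ) (m : ↥M), ((β γ m : ↥M) : StoneCech Γ) = σ γ (m : StoneCech Γ))
    (hr : Continuous r) (hrM : ∀ m : M, r m = m) (hre : ∀ γ, r (stoneCechUnit γ) = β γ e)
    {f g : C(M, ℕ)} (h : wE (til β e f) (til β e g)) : TypeRel β f g := by
  rw [til_eq hr hre, til_eq hr hre] at h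
  have := typeRel_of_wE hσ hβ _ _ h
  rwa [res_eq hr hrM, res_eq hr hrM] at this

theorem typeRel_of_wLe (hMcl : IsClosed M)
    (hσ : ∀ (γ : Γ) (x : Γ), σ γ (stoneCechUnit x) = stoneCechUnit (γ * x))
    (hβ : ∀ (γ : Γ) (m : ↥M), ((β γ m : ↥M) : StoneCech Γ) = σ γ (m : StoneCech Γ))
    (hr : Continuous r) (hrM : ∀ m : M, r m = m) (hre : ∀ γ, r (stoneCechUnit γ) = β γ e)
    {f g : C(M, ℕ)} (h : wLe (til β e f) (til β e g)) : ∃ k, TypeRel β (f + k) g := by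
  haveI : CompactSpace M := isCompact_iff_compactSpace.1 hMcl.isCompact
  obtain ⟨K, hK, h⟩ := wLe_compl h
  obtain ⟨N, hN⟩ := nat_bdd g
  obtain ⟨K', hK'⟩ := nat_ext K N (fun x => (hK x).trans (hN _))
  refine ⟨resM M K', ?_⟩
  have := typeRel_of_wE hσ hβ (f.comp ⟨r, hr⟩ + K') (g.comp ⟨r, hr⟩) ?_
  · rw [res_eq hr hrM] at this
    convert this using 1
    conv_lhs => rw [← res_eq hr hrM f]
    rfl
  · rw [til_eq hr hre, til_eq hr hre] at h
    convert h using 1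
    ext x
    simp [hK']

theorem tle_iff (hMcl : IsClosed M)
    (hσ : ∀ (γ : Γ) (x : Γ), σ γ (stoneCechUnit x) = stoneCechUnit (γ * x))
    (hβ : ∀ (γ : Γ) (m : ↥M), ((β γ m : ↥M) : StoneCech Γ) = σ γ (m : StoneCech Γ))
    (hr : Continuous r) (hrM : ∀ m : M, r m = m) (hre : ∀ γ, r (stoneCechUnit γ) = β γ e)
    (f g : C(M, ℕ)) : tle β (cls β f) (cls β g) ↔ wLe (til β e f) (til β e g) := by
  constructor
  · rintro ⟨c, hc⟩
    induction c using AddCon.induction_on with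
    | H k =>
      have : typeCon β (f + k) g := (AddCon.eq _).1 hc
      exact wLe_of_add (wE_of_typeCon e this)
  · intro h
    obtain ⟨k, hk⟩ := typeRel_of_wLe hMcl hσ hβ hr hrM hre h
    exact ⟨cls β k, (AddCon.eq _).2 (typeCon_of_typeRel hk)⟩

theorem part_unperf (hMcl : IsClosed M)
    (hσ : ∀ (γ : Γ) (x : Γ), σ γ (stoneCechUnit x) = stoneCechUnit (γ * x))
    (hβ : ∀ (γ : Γ) (m : ↥M), ((β γ m : ↥M) : StoneCech Γ) = σ γ (m : StoneCech Γ))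
    (hr : Continuous r) (hrM : ∀ m : M, r m = m) (hre : ∀ γ, r (stoneCechUnit γ) = β γ e) :
    IsUnperforated β := by
  intro a b n hn h
  induction a using AddCon.induction_on with
  | H f =>
  induction b using AddCon.induction_on with
  | H g =>
  refine (tle_iff hMcl hσ hβ hr hrM hre f g).2 ?_
  have h' : tle β (cls β (n • f)) (cls β (n • g)) := h
  rw [tle_iff hMcl hσ hβ hr hrM hre, til_nsmul, til_nsmul] at h'
  exact wLe_unperf hn h'

theorem part_antisymm (hMcl : IsClosed M)
    (hσ : ∀ (γ : Γ) (x : Γ), σ γ (stoneCechUnit x) = stoneCechUnit (γ * x))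
    (hβ : ∀ (γ : Γ) (m : ↥M), ((β γ m : ↥M) : StoneCech Γ) = σ γ (m : StoneCech Γ))
    (hr : Continuous r) (hrM : ∀ m : M, r m = m) (hre : ∀ γ, r (stoneCechUnit γ) = β γ e) :
    TleAntisymm β := by
  intro a b h h'
  induction a using AddCon.induction_on with
  | H f =>
  induction b using AddCon.induction_on with
  | H g =>
  have h1 := (tle_iff hMcl hσ hβ hr hrM hre f g).1 h
  have h2 := (tle_iff hMcl hσ hβ hr hrM hre g f).1 h'
  exact (AddCon.eq _).2 (typeCon_of_typeRel (typeRel_iff hσ hβ hr hrM hre (wLe_antisymm h1 h2)))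

end Flow

theorem iter_aux {T : Type*} [AddCommMonoid T] [PartialOrder T] [IsOrderedAddMonoid T]
    {x y s : T} (h : x + s ≤ y + s) (m : ℕ) : m • x + s ≤ m • y + s := by
  induction m with
  | zero => simp
  | succ m ih =>
    calc (m + 1) • x + s = m • x + (x + s) := by rw [succ_nsmul, add_assoc]
      _ ≤ m • x + (y + s) := by gcongr
      _ = (m • x + s) + y := by abel
      _ ≤ (m • y + s) + y := by gcongr
      _ = (m + 1) • y + s := by rw [succ_nsmul]; abel

theorem compare_aux {T : Type*} [AddCommMonoid T] [PartialOrder T] [IsOrderedAddMonoid T]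
    (h0 : ∀ x : T, 0 ≤ x)
    (hun : ∀ (a b : T) (n : ℕ), 1 ≤ n → n • a ≤ n • b → a ≤ b)
    (a b c u : T) (n k : ℕ) (hn : 1 ≤ n) (hk : 1 ≤ k) (h : n • a + u + c ≤ n • b + c)
    (hc : c ≤ k • b) (hb : b ≤ u) : a ≤ b := by
  have h1 := iter_aux h (2 * k)
  obtain ⟨q, hq⟩ : ∃ q, 2 * k * n = q + k := ⟨2 * k * n - k, by
    have : k * 1 ≤ k * n := Nat.mul_le_mul_left k hn
    have : 2 * k * n = k * n + k * n := by ring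
    omega⟩
  have h2 : (2 * k * n) • a + (2 * k) • b ≤ q • b + (2 * k) • b := by
    calc (2 * k * n) • a + (2 * k) • b = (2 * k) • (n • a + b) + 0 := by
          rw [nsmul_add, mul_nsmul', add_zero]
      _ ≤ (2 * k) • (n • a + u) + c := by
          gcongr
          exact h0 c
      _ ≤ (2 * k) • (n • b) + c := h1
      _ ≤ (2 * k) • (n • b) + k • b := by gcongr
      _ = _ := by
        rw [← mul_nsmul', hq, ← add_nsmul, ← add_nsmul]; congr 1; omega
  have h3 := iter_aux h2 2
  refine hun a b (2 * (2 * k * n)) (by nlinarith [Nat.mul_le_mul hk hn]) ?_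
  calc (2 * (2 * k * n)) • a = 2 • ((2 * k * n) • a) + 0 := by rw [mul_nsmul', add_zero]
    _ ≤ 2 • ((2 * k * n) • a) + (2 * k) • b := by gcongr; exact h0 _
    _ ≤ _ := h3
    _ = _ := by rw [← mul_nsmul', ← add_nsmul, hq]; congr 1; ring

section HB

variable {Γ : Type*} [Group Γ] {X : Type*} [TopologicalSpace X]

/-- real indicator of a clopen set -/
noncomputable def chi {A : Set X} (hA : IsClopen A) : C(X, ℝ) :=
  ⟨A.indicator (fun _ => 1), hA.continuous_indicator continuous_const⟩

/-- natural indicator of a clopen set -/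
noncomputable def chiN {A : Set X} (hA : IsClopen A) : C(X, ℕ) :=
  ⟨A.indicator (fun _ => 1), hA.continuous_indicator continuous_const⟩

/-- the coboundaries -/
def cob (α : Γ →* X ≃ₜ X) : Submodule ℝ C(X, ℝ) :=
  Submodule.span ℝ {g | ∃ (f : C(X, ℝ)) (γ : Γ), g = f - f.comp (α γ)}

theorem measure_of_functional [CompactSpace X] [T2Space X] (α : Γ →* X ≃ₜ X) 
    (ψ : C(X, ℝ) →ₗ[ℝ] ℝ) (hpos : ∀ f : C(X, ℝ), (∀ x, 0 ≤ f x) → 0 ≤ ψ f) (h1 : ψ 1 = 1)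
    (hinv : ∀ (f : C(X, ℝ)) (γ : Γ), ψ (f.comp (α γ)) = ψ f) :
    ∃ μ ∈ invRadon α, ∀ (A : Set X) (hA : IsClopen A), μ A = ENNReal.ofReal (ψ (chi hA)) := by
  letI : MeasurableSpace X := borel X
  haveI : BorelSpace X := ⟨rfl⟩
  let Λ : CompactlySupportedContinuousMap X ℝ →ₚ[ℝ] ℝ :=
  { toFun g := ψ g.toContinuousMap
    map_add' g g' := by rw [← map_add]; rfl
    map_smul' c g := by 
      simp only [RingHom.id_apply]
      rw [← map_smul]; rfl
    monotone' g g' hgg' := by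
      have := hpos (g'.toContinuousMap - g.toContinuousMap) (fun x => by
        simpa using hgg' x)
      rw [map_sub] at this
      linarith }
  let μ := RealRMK.rieszMeasure Λ
  have hint : ∀ f : C(X, ℝ), ∫ x, f x ∂μ = ψ f := by
    intro f
    exact RealRMK.integral_rieszMeasure Λ ⟨f, HasCompactSupport.of_compactSpace _⟩
  haveI : IsFiniteMeasure μ := by infer_instance
  have hA : ∀ (A : Set X) (hA : IsClopen A), μ A = ENNReal.ofReal (ψ (chi hA)) := by
    intro A hA
    rw [← hint]
    have : ∫ x, (chi hA) x ∂μ = μ.real A := by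
      simp only [chi, ContinuousMap.coe_mk]
      exact integral_indicator_one hA.2.measurableSet
    rw [this]
    simp
  refine ⟨μ, ⟨⟨?_⟩, by infer_instance, fun γ => ?_⟩, hA⟩
  · rw [hA _ isClopen_univ]
    have : (chi isClopen_univ : C(X, ℝ)) = 1 := by ext x; simp [chi]
    simp [this, h1]
  · haveI : μ.Regular := by infer_instance
    haveI : (Measure.map (α γ) μ).Regular := Measure.Regular.map (α γ)
    refine Measure.ext_of_integral_eq_on_compactlySupported fun f => ?_
    rw [(α γ).measurableEmbedding.integral_map]
    have e1 := hint (f.toContinuousMap.comp (α γ))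
    rw [hinv, ← hint] at e1
    exact e1

theorem hb_main [CompactSpace X] [T2Space X] [Nonempty X] (α : Γ →* X ≃ₜ X) {A B : Set X} 
    (hA : IsClopen A) (hB : IsClopen B) (h : ∀ μ ∈ invRadon α, μ A < μ B) :
    ∃ l ∈ cob α, ∃ τ : ℝ, 0 ≤ τ ∧ ∀ x, 0 < l x + τ * (chi hB x - chi hA x) := by
  by_contra! hcon
  let s : Set C(X, ℝ) := {f | ∀ x, 0 < f x}
  let t : Set C(X, ℝ) := {f | ∃ l ∈ cob α, ∃ τ : ℝ, 0 ≤ τ ∧ f = l + τ • (chi hB - chi hA)}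
  have hs1 : Convex ℝ s := by
    intro f hf g hg a b ha hb hab x
    simp only [ContinuousMap.add_apply, ContinuousMap.smul_apply, smul_eq_mul]
    rcases ha.eq_or_lt with rfl | ha
    · simp at hab; subst hab; simpa using hg x
    · have := mul_pos ha (hf x)
      have := mul_nonneg hb (hg x).le
      linarith
  have hs2 : IsOpen s := by
    have : s = {f : C(X, ℝ) | MapsTo f univ (Ioi 0)} := by
      ext f; simp [s, MapsTo]
    rw [this]
    exact ContinuousMap.isOpen_setOfPred_mapsTo isCompact_univ isOpen_Ioi
  have ht : Convex ℝ t := by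
    rintro _ ⟨l, hl, τ, hτ, rfl⟩ _ ⟨l', hl', τ', hτ', rfl⟩ a b ha hb hab
    refine ⟨a • l + b • l', add_mem (Submodule.smul_mem _ _ hl) (Submodule.smul_mem _ _ hl'), 
      a * τ + b * τ', by positivity, ?_⟩
    module
  have hd : Disjoint s t := by
    rw [Set.disjoint_left]
    rintro _ hf ⟨l, hl, τ, hτ, rfl⟩
    obtain ⟨x, hx⟩ := hcon l hl τ hτ
    have := hf x
    simp only [ContinuousMap.add_apply, ContinuousMap.smul_apply, smul_eq_mul, 
      ContinuousMap.sub_apply] at this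
    linarith
  obtain ⟨φ, u, hφs, hφt⟩ := geometric_hahn_banach_open hs1 hs2 ht hd
  have hu : u ≤ 0 := by
    have := hφt 0 ⟨0, zero_mem _, 0, le_rfl, by simp⟩
    simpa using this
  have ht0 : ∀ g ∈ t, 0 ≤ φ g := by
    intro g hg
    by_contra! hneg
    obtain ⟨l, hl, τ, hτ, rfl⟩ := hg
    set g := l + τ • (chi hB - chi hA) with hgdef
    have hc : 0 ≤ (u - 1) / φ g := div_nonneg_of_nonpos (by linarith) hneg.le
    have := hφt (((u - 1) / φ g) • g) ⟨((u - 1) / φ g) • l, Submodule.smul_mem _ _ hl, 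
      ((u - 1) / φ g) * τ, by positivity, by rw [hgdef]; module⟩
    rw [map_smul, smul_eq_mul, div_mul_cancel₀ _ hneg.ne] at this
    linarith
  have hneg : ∀ f ∈ s, φ f < 0 := fun f hf => (hφs f hf).trans_le hu
  have hL : ∀ l ∈ cob α, φ l = 0 := by
    intro l hl
    have a1 := ht0 l ⟨l, hl, 0, le_rfl, by simp⟩
    have a2 := ht0 (-l) ⟨-l, neg_mem hl, 0, le_rfl, by simp⟩
    rw [map_neg] at a2
    linarith
  have hone : φ 1 < 0 := hneg 1 (fun x => by simp)
  have hAB : 0 ≤ φ (chi hB - chi hA) := ht0 _ ⟨0, zero_mem _, 1, zero_le_one, by simp⟩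
  have hpos : ∀ f : C(X, ℝ), (∀ x, 0 ≤ f x) → φ f ≤ 0 := by
    intro f hf
    by_contra! hlt
    have hc : 0 < φ f / (-2 * φ 1) := div_pos hlt (by linarith)
    have := hneg (f + (φ f / (-2 * φ 1)) • 1) (fun x => by
      simp only [ContinuousMap.add_apply, ContinuousMap.smul_apply, smul_eq_mul, 
        ContinuousMap.one_apply, mul_one]
      linarith [hf x])
    rw [map_add, map_smul, smul_eq_mul] at this
    have e : φ f / (-2 * φ 1) * φ 1 = - (φ f / 2) := by
      have := hone.ne
      field_simp
    rw [e] at this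
    linarith
  obtain ⟨μ, hμ, hμA⟩ := measure_of_functional α ((φ 1)⁻¹ • (φ : C(X, ℝ) →ₗ[ℝ] ℝ)) 
    (fun f hf => by
      simp only [LinearMap.smul_apply, ContinuousLinearMap.coe_coe, smul_eq_mul]
      exact mul_nonneg_of_nonpos_of_nonpos (inv_nonpos.2 hone.le) (hpos f hf))
    (by simp [hone.ne])
    (fun f γ => by
      have := hL (f - f.comp (α γ)) (Submodule.subset_span ⟨f, γ, rfl⟩)
      rw [map_sub] at this
      simp only [LinearMap.smul_apply, ContinuousLinearMap.coe_coe, smul_eq_mul]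
      congr 1; linarith)
  have hlt := h μ hμ
  rw [hμA A hA, hμA B hB] at hlt
  refine absurd hlt (not_lt.2 (ENNReal.ofReal_le_ofReal ?_))
  simp only [LinearMap.smul_apply, ContinuousLinearMap.coe_coe, smul_eq_mul]
  rw [map_sub] at hAB
  exact mul_le_mul_of_nonpos_left (by linarith) (inv_nonpos.2 hone.le)

end HB

section Cmp

variable {Γ : Type*} [Group Γ] [TopologicalSpace Γ] [DiscreteTopology Γ]
    {σ : Γ →* (StoneCech Γ ≃ₜ StoneCech Γ)}
    {M : Set (StoneCech Γ)}
    {β : Γ →* (↥M ≃ₜ ↥M)}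
    {e : M} {r : StoneCech Γ → M}

theorem approx_nat [CompactSpace M] (hr : Continuous r) (hrM : ∀ m : M, r m = m) (f : C(M, ℝ)) :
    ∃ (F : C(M, ℕ)) (k : ℝ), ∀ m, |f m + k - F m| ≤ 1 := by
  obtain ⟨K, hK⟩ := exists_nat_ge ‖f‖
  have hb : ∀ m, |f m| ≤ K := fun m => (f.norm_coe_le_norm m).trans hK
  obtain ⟨F', hF'⟩ := nat_ext (fun γ : Γ => ⌊f (r (stoneCechUnit γ)) + K⌋₊) (2 * K) (fun x => by
    refine Nat.floor_le_of_le ?_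
    have := abs_le.1 (hb (r (stoneCechUnit x)))
    push_cast
    linarith)
  have key : ∀ x, |f (r x) + K - (F' x : ℝ)| ≤ 1 := by
    intro x
    refine denseRange_stoneCechUnit.induction_on (p := fun x => |f (r x) + K - (F' x : ℝ)| ≤ 1) x ?_ ?_
    · refine isClosed_le ?_ continuous_const
      have h1 : Continuous fun x => (F' x : ℝ) := 
        (continuous_of_discreteTopology (f := (Nat.cast : ℕ → ℝ))).comp F'.continuous
      have h2 : Continuous fun x => f (r x) := f.continuous.comp hr
      fun_prop
    · intro γ
      simp only [hF']
      have := abs_le.1 (hb (r (stoneCechUnit γ)))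
      have h1 := Nat.floor_le (a := f (r (stoneCechUnit γ)) + K) (by linarith)
      have h2 := Nat.lt_floor_add_one (f (r (stoneCechUnit γ)) + K)
      rw [abs_le]
      constructor <;> linarith
  refine ⟨resM M F', K, fun m => ?_⟩
  have := key m
  rwa [hrM] at this

theorem cls_actC (γ : Γ) (f : C(M, ℕ)) : cls β (actC β γ f) = cls β f :=
  ((AddCon.eq _).2 (typeCon_of_typeRel ⟨1, fun _ => f, fun _ => γ, by simp, by simp⟩)).symm

theorem cls_add (f g : C(M, ℕ)) : cls β (f + g) = cls β f + cls β g := rfl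

theorem cls_nsmul (n : ℕ) (f : C(M, ℕ)) : cls β (n • f) = n • cls β f := rfl

theorem cls_sum {ι : Type*} (S : Finset ι) (f : ι → C(M, ℕ)) :
    cls β (∑ i ∈ S, f i) = ∑ i ∈ S, cls β (f i) :=
  map_sum (typeCon β).mk' f S

theorem tle_of_le {f g : C(M, ℕ)} (h : ∀ x, f x ≤ g x) : tle β (cls β f) (cls β g) := by
  let k : C(M, ℕ) := ⟨fun x => g x - f x, 
    (continuous_of_discreteTopology (f := fun p : ℕ × ℕ => p.1 - p.2)).comp 
      (g.continuous.prodMk f.continuous)⟩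
  refine ⟨cls β k, ?_⟩
  rw [← cls_add]
  congr 1
  ext x
  simp [k, h x]

theorem cob_approx [CompactSpace M] (hr : Continuous r) (hrM : ∀ m : M, r m = m) 
    (l : C(M, ℝ)) (hl : l ∈ cob β) : ∃ C : ℝ, ∀ t : ℝ, ∃ F G : C(M, ℕ), cls β F = cls β G ∧
      ∀ x, |t * l x - ((F x : ℝ) - G x)| ≤ C := by
  induction hl using Submodule.span_induction with
  | mem l hl =>
    obtain ⟨f, γ, rfl⟩ := hl
    refine ⟨2, fun t => ?_⟩
    obtain ⟨F, k, hF⟩ := approx_nat hr hrM (t • f)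
    refine ⟨F, actC β γ⁻¹ F, (cls_actC _ _).symm, fun x => ?_⟩
    have h1 := abs_le.1 (hF x)
    have h2 := abs_le.1 (hF (β γ x))
    simp only [actC, inv_inv, ContinuousMap.sub_apply, ContinuousMap.comp_apply, 
      ContinuousMap.smul_apply, smul_eq_mul, ContinuousMap.coe_coe] at h1 h2 ⊢
    rw [abs_le]
    constructor <;> linarith
  | zero => exact ⟨0, fun t => ⟨0, 0, rfl, fun x => by simp⟩⟩
  | add l l' _ _ ih ih' =>
    obtain ⟨C, hC⟩ := ih
    obtain ⟨C', hC'⟩ := ih'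
    refine ⟨C + C', fun t => ?_⟩
    obtain ⟨F, G, h, hF⟩ := hC t
    obtain ⟨F', G', h', hF'⟩ := hC' t
    refine ⟨F + F', G + G', by rw [cls_add, cls_add, h, h'], fun x => ?_⟩
    have h1 := abs_le.1 (hF x)
    have h2 := abs_le.1 (hF' x)
    simp only [ContinuousMap.add_apply, Nat.cast_add]
    rw [abs_le]
    constructor <;> linarith
  | smul c l _ ih =>
    obtain ⟨C, hC⟩ := ih
    refine ⟨C, fun t => ?_⟩
    obtain ⟨F, G, h, hF⟩ := hC (t * c)
    refine ⟨F, G, h, fun x => ?_⟩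
    simpa [mul_assoc] using hF x

theorem order_unit (hMcl : IsClosed M)
    (hMmin : ∀ N : Set (StoneCech Γ), N ⊆ M → N.Nonempty → IsClosed N →
      (∀ γ : Γ, ⇑(σ γ) '' N ⊆ N) → N = M)
    (hβ : ∀ (γ : Γ) (m : ↥M), ((β γ m : ↥M) : StoneCech Γ) = σ γ (m : StoneCech Γ))
    {B : Set M} (hB : IsClopen B) (hBne : B.Nonempty) (f : C(M, ℕ)) :
    ∃ k : ℕ, 1 ≤ k ∧ tle β (cls β f) (k • cls β (chiN hB)) := by
  haveI : CompactSpace M := isCompact_iff_compactSpace.1 hMcl.isCompact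
  have hhit : ∀ x : M, ∃ γ, β γ x ∈ B := by
    by_contra! hcon
    obtain ⟨x, hx⟩ := hcon
    have hN := hMmin (Subtype.val '' {m : M | ∀ γ, β γ m ∉ B}) 
      (by rintro _ ⟨m, -, rfl⟩; exact m.2) ⟨x, x, hx, rfl⟩ ?_ ?_
    · obtain ⟨b, hb⟩ := hBne
      obtain ⟨m', hm', h⟩ := hN.ge b.2
      have := hm' 1
      rw [alpha_one, Subtype.ext h] at this
      exact this hb
    · refine hMcl.isClosedMap_subtype_val _ ?_
      have : {m : M | ∀ γ, β γ m ∉ B} = ⋂ γ, (β γ) ⁻¹' Bᶜ := by ext; simp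
      rw [this]
      exact isClosed_iInter fun γ => hB.2.isClosed_compl.preimage (β γ).continuous
    · rintro γ _ ⟨_, ⟨m, hm, rfl⟩, rfl⟩
      refine ⟨β γ m, fun δ => ?_, hβ γ m⟩
      rw [← alpha_mul]
      exact hm _
  obtain ⟨t, ht⟩ := isCompact_univ.elim_finite_subcover (fun γ => (β γ) ⁻¹' B)
    (fun γ => hB.2.preimage (β γ).continuous) (fun x _ => by
      obtain ⟨γ, hγ⟩ := hhit x
      exact mem_iUnion.2 ⟨γ, hγ⟩)
  obtain ⟨K, hK⟩ := nat_bdd f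
  have h1 : tle β (cls β f) (cls β ((K + 1) • ∑ γ ∈ t, actC β γ⁻¹ (chiN hB))) := by
    refine tle_of_le fun x => ?_
    obtain ⟨γ, hγ, hx⟩ := mem_iUnion₂.1 (ht (mem_univ x))
    have hx' : β γ x ∈ B := hx
    have h2 : 1 ≤ ∑ γ ∈ t, actC β γ⁻¹ (chiN hB) x := by
      calc 1 = actC β γ⁻¹ (chiN hB) x := by simp [actC, chiN, hx']
        _ ≤ _ := Finset.single_le_sum (f := fun γ => actC β γ⁻¹ (chiN hB) x) 
          (fun _ _ => Nat.zero_le _) hγ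
    simp only [ContinuousMap.smul_apply, ContinuousMap.sum_apply, smul_eq_mul]
    nlinarith [hK x]
  have htne : 1 ≤ t.card := by
    obtain ⟨b, hb⟩ := hBne
    obtain ⟨γ, hγ, hx⟩ := mem_iUnion₂.1 (ht (mem_univ b))
    exact Finset.card_pos.2 ⟨γ, hγ⟩
  refine ⟨(K + 1) * t.card, by nlinarith, ?_⟩
  rw [cls_nsmul, cls_sum, Finset.sum_congr rfl (fun γ _ => cls_actC γ⁻¹ (chiN hB)), 
    Finset.sum_const, ← mul_nsmul'] at h1
  exact h1

theorem subeq_of_typeRel {A B : Set M} (hA : IsClopen A) (hB : IsClopen B) (k : C(M, ℕ))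
    (h : TypeRel β (chiN hA + k) (chiN hB)) : Subequidecomposable β A B := by
  obtain ⟨n, h, γ, h1, h2⟩ := h
  have hB1 : ∀ x, ∑ i, h i (β (γ i)⁻¹ x) = B.indicator (fun _ => 1) x := by
    intro x
    have := congrArg (fun f : C(M, ℕ) => f x) h2
    simp only [ContinuousMap.sum_apply] at this
    exact this.symm
  have hA1 : ∀ x ∈ A, 1 ≤ ∑ i, h i x := by
    intro x hx
    have := congrArg (fun f : C(M, ℕ) => f x) h1
    simp only [ContinuousMap.sum_apply, ContinuousMap.add_apply] at this
    rw [← this]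
    simp [chiN, hx]
  let P : Fin n → Set M := fun i => A ∩ ({x | h i x ≠ 0} ∩ ⋂ j, ⋂ (_ : j < i), {x | h j x = 0})
  have hcl : ∀ (i : Fin n) (s : Set ℕ), IsClopen {x | h i x ∈ s} := fun i s => 
    (isClopen_discrete s).preimage (h i).continuous
  have hPB : ∀ i, ∀ y ∈ ⇑(β (γ i)) '' P i, h i (β (γ i)⁻¹ y) ≠ 0 := by
    rintro i _ ⟨x, hx, rfl⟩
    rw [alpha_inv]
    exact hx.2.1
  refine ⟨n, P, γ, ?_, ?_, ?_, ?_, ?_⟩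
  · intro i
    refine hA.inter ((hcl i {0}ᶜ).inter ?_)
    refine isClopen_iInter_of_finite fun j => isClopen_iInter_of_finite fun _ => hcl j {0}
  · intro i j hij
    rw [Set.disjoint_left]
    intro x hx hx'
    rcases lt_or_gt_of_ne hij with hlt | hlt
    · exact hx.2.1 (mem_iInter₂.1 hx'.2.2 i hlt)
    · exact hx'.2.1 (mem_iInter₂.1 hx.2.2 j hlt)
  · apply Set.Subset.antisymm
    · exact iUnion_subset fun i => inter_subset_left
    · intro x hx
      have hex : ∃ i, h i x ≠ 0 := by
        by_contra! hcon
        have := hA1 x hx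
        simp [hcon] at this
      classical
      obtain ⟨i, hi⟩ := Finset.exists_minimal (s := Finset.univ.filter (fun i => h i x ≠ 0))
        (by obtain ⟨i, hi⟩ := hex; exact ⟨i, by simp [hi]⟩)
      have hmin := hi.2
      have hi := hi.1
      refine mem_iUnion.2 ⟨i, hx, by simpa using hi, mem_iInter₂.2 fun j hj => ?_⟩
      by_contra hne
      have := hmin (y := j) (by simpa using hne) hj.le
      exact absurd hj (not_lt.2 this)
  · intro i j hij
    rw [Set.disjoint_left]
    intro y hy hy'
    have h3 := hPB i y hy
    have h4 := hPB j y hy'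
    have h5 : h i (β (γ i)⁻¹ y) + h j (β (γ j)⁻¹ y) ≤ ∑ i, h i (β (γ i)⁻¹ y) := by
      classical
      rw [← Finset.sum_pair (f := fun i => h i (β (γ i)⁻¹ y)) hij]
      exact Finset.sum_le_sum_of_subset (Finset.subset_univ _)
    rw [hB1] at h5
    have : B.indicator (fun _ => 1) y ≤ 1 := by
      by_cases hy : y ∈ B <;> simp [hy]
    omega
  · intro i y hy
    by_contra hyB
    have h3 := hPB i y hy
    have h5 := Finset.single_le_sum (f := fun i => h i (β (γ i)⁻¹ y)) 
      (fun _ _ => Nat.zero_le _) (Finset.mem_univ i)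
    rw [hB1] at h5
    rw [Set.indicator_of_notMem hyB] at h5
    exact h3 (Nat.le_zero.1 h5)

theorem part_cmp (hMcl : IsClosed M)
    (hσ : ∀ (γ : Γ) (x : Γ), σ γ (stoneCechUnit x) = stoneCechUnit (γ * x))
    (hMmin : ∀ N : Set (StoneCech Γ), N ⊆ M → N.Nonempty → IsClosed N →
      (∀ γ : Γ, ⇑(σ γ) '' N ⊆ N) → N = M)
    (hβ : ∀ (γ : Γ) (m : ↥M), ((β γ m : ↥M) : StoneCech Γ) = σ γ (m : StoneCech Γ))
    (hr : Continuous r) (hrM : ∀ m : M, r m = m) (hre : ∀ γ, r (stoneCechUnit γ) = β γ e) :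
    DynComparison β := by
  intro A B hA hB hBne hμ
  haveI : CompactSpace M := isCompact_iff_compactSpace.1 hMcl.isCompact
  haveI : Nonempty M := ⟨e⟩
  obtain ⟨l, hl, τ, hτ, hpos⟩ := hb_main β hA hB hμ
  obtain ⟨ε, hε, hle⟩ : ∃ ε : ℝ, 0 < ε ∧ ∀ x, ε ≤ l x + τ * (chi hB x - chi hA x) := by
    obtain ⟨x, -, hx⟩ := isCompact_univ.exists_isMinOn (univ_nonempty (α := M))
      (f := fun x => l x + τ * (chi hB x - chi hA x)) (by fun_prop)
    exact ⟨_, hpos x, fun y => hx (mem_univ y)⟩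
  obtain ⟨C, hC⟩ := cob_approx hr hrM l hl
  obtain ⟨t, ht0, ht⟩ : ∃ t : ℝ, 0 ≤ t ∧ t * ε = |C| + 3 :=
    ⟨(|C| + 3) / ε, by positivity, by field_simp⟩
  obtain ⟨F, G, hFG, hF⟩ := hC t
  let n := ⌈t * τ⌉₊ + 1
  have hn1 : t * τ ≤ n := by
    have := Nat.le_ceil (t * τ)
    simp only [n]; push_cast; linarith
  have hn2 : (n : ℝ) ≤ t * τ + 2 := by
    have := Nat.ceil_lt_add_one (mul_nonneg ht0 hτ)
    simp only [n]; push_cast; linarith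
  have hchi : ∀ {D : Set M} (hD : IsClopen D) (x : M), chi hD x = (chiN hD x : ℝ) := by
    intro D hD x
    by_cases hx : x ∈ D <;> simp [chi, chiN, hx]
  have hchi1 : ∀ {D : Set M} (hD : IsClopen D) (x : M), chiN hD x ≤ 1 := by
    intro D hD x
    by_cases hx : x ∈ D <;> simp [chiN, hx]
  have hpt : ∀ x, (n • chiN hA + 1 + G) x ≤ (n • chiN hB + F) x := by
    intro x
    have h1 := abs_le.1 (hF x)
    have h2 := mul_le_mul_of_nonneg_left (hle x) ht0
    rw [ht, hchi, hchi] at h2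
    have a1 : (chiN hA x : ℝ) ≤ 1 := by exact_mod_cast hchi1 hA x
    have b1 : (chiN hB x : ℝ) ≤ 1 := by exact_mod_cast hchi1 hB x
    have a0 : (0 : ℝ) ≤ chiN hA x := Nat.cast_nonneg _
    have b0 : (0 : ℝ) ≤ chiN hB x := Nat.cast_nonneg _
    have h3 : (n - t * τ) * ((chiN hB x : ℝ) - chiN hA x) ≥ -2 := by nlinarith
    have h4 := le_abs_self C
    simp only [ContinuousMap.add_apply, ContinuousMap.smul_apply, smul_eq_mul, 
      ContinuousMap.one_apply]
    have : (n * chiN hA x + 1 + G x : ℝ) ≤ n * chiN hB x + F x := by nlinarith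
    exact_mod_cast this
  have hT : tle β (n • cls β (chiN hA) + cls β 1 + cls β G) (n • cls β (chiN hB) + cls β G) := by
    have := tle_of_le (β := β) hpt
    rw [cls_add, cls_add, cls_add, cls_nsmul, cls_nsmul, hFG] at this
    exact this
  obtain ⟨k, hk1, hk⟩ := order_unit hMcl hMmin hβ hB hBne G
  have hb1 : tle β (cls β (chiN hB)) (cls β 1) := tle_of_le (fun x => by simpa using hchi1 hB x)
  have hun := part_unperf hMcl hσ hβ hr hrM hre
  have han := part_antisymm hMcl hσ hβ hr hrM hre
  have hfin : tle β (cls β (chiN hA)) (cls β (chiN hB)) := by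
    letI : PartialOrder (TypeSemigroup β) :=
      { le := tle β
        le_refl := fun a => ⟨0, add_zero a⟩
        le_trans := by
          rintro a b c ⟨x, rfl⟩ ⟨y, rfl⟩
          exact ⟨x + y, (add_assoc _ _ _).symm⟩
        le_antisymm := fun a b h h' => han a b h h' }
    haveI : IsOrderedAddMonoid (TypeSemigroup β) :=
      { add_le_add_left := by
          rintro a b ⟨x, rfl⟩ c
          exact ⟨x, by abel⟩ }
    exact compare_aux (fun x => (show tle β 0 x from ⟨x, zero_add x⟩)) hun _ _ (cls β G) (cls β 1) n k 
      (by simp [n]) hk1 hT hk hb1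
  rw [tle_iff hMcl hσ hβ hr hrM hre] at hfin
  obtain ⟨k', hk'⟩ := typeRel_of_wLe hMcl hσ hβ hr hrM hre hfin
  exact subeq_of_typeRel hA hB k' hk'

end Cmp

/-- Let `Γ` be a countable (discrete) group, `σ` the canonical action of
`Γ` on its Stone–Čech compactification `βΓ` (the continuous extension of left translation)
and `M ⊆ βΓ` a minimal subflow, with induced action `β` of `Γ` on `M`. Then the clopen
type semigroup `T(Γ ↷ M)` is unperforated, its algebraic preorder is a partial order, and
the action `Γ ↷ M` has dynamical comparison. -/
theorem stmt1 {Γ : Type*} [Group Γ] [Countable Γ]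
    [TopologicalSpace Γ] [DiscreteTopology Γ]
    (σ : Γ →* (StoneCech Γ ≃ₜ StoneCech Γ))
    (hσ : ∀ (γ : Γ) (x : Γ), σ γ (stoneCechUnit x) = stoneCechUnit (γ * x))
    (M : Set (StoneCech Γ)) (hMne : M.Nonempty) (hMcl : IsClosed M)
    (hMinv : ∀ γ : Γ, ⇑(σ γ) '' M ⊆ M)
    (hMmin : ∀ N : Set (StoneCech Γ), N ⊆ M → N.Nonempty → IsClosed N →
      (∀ γ : Γ, ⇑(σ γ) '' N ⊆ N) → N = M)
    (β : Γ →* (↥M ≃ₜ ↥M))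
    (hβ : ∀ (γ : Γ) (m : ↥M), ((β γ m : ↥M) : StoneCech Γ) = σ γ (m : StoneCech Γ)) :
    IsUnperforated β ∧ TleAntisymm β ∧ DynComparison β := by
  obtain ⟨e, r, hr, hrM, hre⟩ := exists_retract σ hσ M hMne hMcl hMmin β hβ
  exact ⟨part_unperf hMcl hσ hβ hr hrM hre, part_antisymm hMcl hσ hβ hr hrM hre,
    part_cmp hMcl hσ hMmin hβ hr hrM hre⟩
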